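/- arXiv:1306.3142 — 2 statements merged into one kernel-verified Lean document; each statement's English description precedes it below -/
import Mathlib

section
/- Let n ≥ 1, let α ∈ [1/2, 1) ∪ (1, ∞), and let ρ, σ be positive semidefinite complex n×n matrices with ρ ≠ 0. If ρ − σ is positive semidefinite, then D̃_α(ρ‖σ) ≥ 0; and if σ − ρ is positive semidefinite, then D̃_α(ρ‖σ) ≤ 0. -/
open Matrix
open scoped Kronecker Classical ComplexOrder

/-- Real power of a matrix via functional calculus on the eigenvalues of a Hermitian
matrix, with the convention that eigenvalue `0` is mapped to `0` (powers are taken on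
the support). Non-Hermitian matrices are mapped to `0`. -/
noncomputable def matPow {n : Type*} [Fintype n] [DecidableEq n]
    (A : Matrix n n ℂ) (t : ℝ) : Matrix n n ℂ :=
  if hA : A.IsHermitian then
    (hA.eigenvectorUnitary : Matrix n n ℂ) *
      Matrix.diagonal (fun i =>
        ((if hA.eigenvalues i = 0 then (0 : ℝ) else hA.eigenvalues i ^ t : ℝ) : ℂ)) *
      (star (hA.eigenvectorUnitary : Matrix n n ℂ))
  else 0

/-- `dominates σ ρ` (written `σ ≫ ρ` in the paper): the kernel of `σ` is contained in
the kernel of `ρ`. -/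
def dominates {n : Type*} [Fintype n] (σ ρ : Matrix n n ℂ) : Prop :=
  ∀ v : n → ℂ, σ.mulVec v = 0 → ρ.mulVec v = 0

/-- The sandwiched Rényi divergence of order `α`, with values in `ℝ ∪ {+∞}` (as a
subset of `EReal`), logarithms base 2. It is `+∞` unless `ρ` is not orthogonal to `σ`
(i.e. `Tr[ρσ] ≠ 0`) and (`σ ≫ ρ` or `α < 1`). -/
noncomputable def Dtilde {n : Type*} [Fintype n] [DecidableEq n]
    (α : ℝ) (ρ σ : Matrix n n ℂ) : EReal :=
  if (ρ * σ).trace ≠ 0 ∧ (dominates σ ρ ∨ α < 1) then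
    (((α - 1)⁻¹ * Real.logb 2
        ((matPow (matPow σ ((1 - α) / (2 * α)) * ρ * matPow σ ((1 - α) / (2 * α))) α).trace.re
          / ρ.trace.re) : ℝ) : EReal)
  else ⊤

open scoped MatrixOrder Matrix.Norms.L2Operator Topology

/-- The function `x ↦ x ^ t`, modified to send `0` to `0`. -/
noncomputable def suppRpow (t x : ℝ) : ℝ := if x = 0 then 0 else x ^ t

lemma suppRpow_eq_rpow {t : ℝ} (ht : t ≠ 0) (x : ℝ) : suppRpow t x = x ^ t := by
  unfold suppRpow
  split_ifs with h
  · rw [h, Real.zero_rpow ht]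
  · rfl

lemma suppRpow_nonneg (t : ℝ) {x : ℝ} (hx : 0 ≤ x) : 0 ≤ suppRpow t x := by
  unfold suppRpow
  split_ifs <;> positivity

lemma suppRpow_mul_suppRpow (s t : ℝ) {x : ℝ} (hx : 0 ≤ x) :
    suppRpow s x * suppRpow t x = suppRpow (s + t) x := by
  unfold suppRpow
  split_ifs with h
  · simp
  · rw [Real.rpow_add (lt_of_le_of_ne hx (Ne.symm h))]

lemma suppRpow_suppRpow (s t : ℝ) {x : ℝ} (hx : 0 ≤ x) :
    suppRpow t (suppRpow s x) = suppRpow (s * t) x := by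
  by_cases h : x = 0
  · simp [suppRpow, h]
  · have hpos : 0 < x := lt_of_le_of_ne hx (Ne.symm h)
    simp [suppRpow, h, (Real.rpow_pos_of_pos hpos s).ne', Real.rpow_mul hx]

section MatrixPowers

variable {m : Type*} [Fintype m] [DecidableEq m] {A B : Matrix m m ℂ}

lemma continuousOn_spectrum (A : Matrix m m ℂ) (f : ℝ → ℝ) : ContinuousOn f (spectrum ℝ A) :=
  A.finite_real_spectrum.continuousOn f

lemma nonneg_of_mem_spectrum (hA : A.PosSemidef) {x : ℝ} (hx : x ∈ spectrum ℝ A) : 0 ≤ x :=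
  spectrum_nonneg_of_nonneg hA.nonneg hx

lemma matPow_eq_cfc (hA : A.IsHermitian) (t : ℝ) : matPow A t = cfc (suppRpow t) A := by
  rw [hA.cfc_eq, matPow, dif_pos hA, IsHermitian.cfc, Unitary.conjStarAlgAut_apply]
  rfl

lemma trace_cfc (hA : A.IsHermitian) (f : ℝ → ℝ) :
    (cfc f A).trace = ((∑ i, f (hA.eigenvalues i) : ℝ) : ℂ) := by
  rw [hA.cfc_eq, IsHermitian.cfc, Unitary.conjStarAlgAut_apply, trace_mul_cycle]
  simp [trace_diagonal]

lemma trace_matPow (hA : A.IsHermitian) (t : ℝ) :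
    (matPow A t).trace.re = ∑ i, suppRpow t (hA.eigenvalues i) := by
  rw [matPow_eq_cfc hA, trace_cfc hA, Complex.ofReal_re]

lemma posSemidef_matPow (hA : A.PosSemidef) (t : ℝ) : (matPow A t).PosSemidef := by
  rw [matPow_eq_cfc hA.1, ← nonneg_iff_posSemidef]
  exact cfc_nonneg fun x hx => suppRpow_nonneg t (nonneg_of_mem_spectrum hA hx)

lemma matPow_mul_matPow (hA : A.PosSemidef) (s t : ℝ) :
    matPow A s * matPow A t = matPow A (s + t) := by
  rw [matPow_eq_cfc hA.1, matPow_eq_cfc hA.1, matPow_eq_cfc hA.1,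
    ← cfc_mul _ _ A (continuousOn_spectrum A _) (continuousOn_spectrum A _)]
  exact cfc_congr fun x hx => suppRpow_mul_suppRpow s t (nonneg_of_mem_spectrum hA hx)

lemma matPow_matPow (hA : A.PosSemidef) (s t : ℝ) :
    matPow (matPow A s) t = matPow A (s * t) := by
  rw [matPow_eq_cfc (posSemidef_matPow hA s).1, matPow_eq_cfc hA.1, matPow_eq_cfc hA.1,
    ← cfc_comp _ _ A hA.1.isSelfAdjoint ((A.finite_real_spectrum.image _).continuousOn _)
      (continuousOn_spectrum A _)]
  exact cfc_congr fun x hx => suppRpow_suppRpow s t (nonneg_of_mem_spectrum hA hx)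

lemma matPow_one (hA : A.IsHermitian) : matPow A 1 = A := by
  rw [matPow_eq_cfc hA]
  conv_rhs => rw [← cfc_id ℝ A hA.isSelfAdjoint]
  exact cfc_congr fun x _ => by simp [suppRpow_eq_rpow]

lemma matPow_eq_rpow (hA : A.PosSemidef) {t : ℝ} (ht : t ≠ 0) : matPow A t = A ^ t := by
  rw [matPow_eq_cfc hA.1, CFC.rpow_eq_cfc_real hA.nonneg]
  exact cfc_congr fun x _ => suppRpow_eq_rpow ht x

lemma matPow_le_matPow (hA : A.PosSemidef) (hAB : A ≤ B) {t : ℝ} (ht : 0 < t) (ht1 : t ≤ 1) :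
    matPow A t ≤ matPow B t := by
  have hB : B.PosSemidef := (hA.nonneg.trans hAB).posSemidef
  rw [matPow_eq_rpow hA ht.ne', matPow_eq_rpow hB ht.ne']
  exact CFC.rpow_le_rpow ⟨ht.le, ht1⟩ hAB

omit [DecidableEq m] in
lemma trace_re_le_trace_re (hAB : A ≤ B) : A.trace.re ≤ B.trace.re := by
  have h : 0 ≤ (B - A).trace := PosSemidef.trace_nonneg hAB
  have := (Complex.le_def.1 h).1
  simp [trace_sub] at this
  exact this

/-- Monotonicity of the trace of a power with exponent at least one. -/
lemma trace_matPow_le_of_one_le (hA : A.PosSemidef) (hAB : A ≤ B) {t : ℝ} (ht : 1 ≤ t) :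
    (matPow A t).trace.re ≤ (matPow B t).trace.re := by
  have hB : B.PosSemidef := (hA.nonneg.trans hAB).posSemidef
  have ht0 : t ≠ 0 := by positivity
  rw [trace_matPow hA.1, trace_matPow hB.1]
  simp only [suppRpow_eq_rpow ht0]
  set U : Matrix m m ℂ := (hA.1.eigenvectorUnitary : Matrix m m ℂ) with hU
  set V : Matrix m m ℂ := (hB.1.eigenvectorUnitary : Matrix m m ℂ) with hV
  have hU1 : star U * U = 1 := Unitary.coe_star_mul_self _
  have hV1 : star V * V = 1 := Unitary.coe_star_mul_self _
  have hV2 : V * star V = 1 := Unitary.coe_mul_star_self _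
  have hU2 : U * star U = 1 := Unitary.coe_mul_star_self _
  set W := star U * V with hW
  have hWs : star W = star V * U := by simp [hW]
  have hW1 : W * star W = 1 := by
    rw [hWs, hW, mul_assoc, ← mul_assoc V, hV2, one_mul, hU1]
  have hW2 : star W * W = 1 := by
    rw [hWs, hW, mul_assoc, ← mul_assoc U, hU2, one_mul, hV1]
  have hrow (i : m) : ∑ j, Complex.normSq (W i j) = 1 := by
    have := congrFun (congrFun hW1 i) i
    simp only [mul_apply, star_apply, one_apply_eq, Complex.star_def, Complex.mul_conj] at this
    exact_mod_cast this
  have hcol (j : m) : ∑ i, Complex.normSq (W i j) = 1 := by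
    have := congrFun (congrFun hW2 j) j
    simp only [mul_apply, star_apply, one_apply_eq, Complex.star_def,
      ← Complex.normSq_eq_conj_mul_self] at this
    exact_mod_cast this
  have hA' : star U * A * U = diagonal (fun i => (hA.1.eigenvalues i : ℂ)) := by
    conv_lhs => rw [hA.1.spectral_theorem, Unitary.conjStarAlgAut_apply, ← hU]
    rw [mul_assoc, mul_assoc, mul_assoc, hU1, mul_one, ← mul_assoc, hU1, one_mul]
    rfl
  have hB' : star U * B * U = W * diagonal (fun i => (hB.1.eigenvalues i : ℂ)) * star W := by
    conv_lhs => rw [hB.1.spectral_theorem, Unitary.conjStarAlgAut_apply, ← hV]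
    rw [hWs, hW]
    simp only [mul_assoc]
    rfl
  have hdiag (i : m) : hA.1.eigenvalues i ≤
      ∑ j, Complex.normSq (W i j) * hB.1.eigenvalues j := by
    have hle : 0 ≤ (star U * B * U - star U * A * U) i i := by
      rw [← sub_mul, ← mul_sub]
      exact (PosSemidef.conjTranspose_mul_mul_same (A := B - A) hAB U).diag_nonneg
    have hre := (Complex.le_def.1 hle).1
    rw [hA', hB', Matrix.sub_apply, diagonal_apply_eq, mul_apply] at hre
    simp only [mul_diagonal, star_apply, Complex.star_def, Complex.sub_re, Complex.ofReal_re,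
      Complex.zero_re, Complex.re_sum, sub_nonneg] at hre
    refine hre.trans_eq (Finset.sum_congr rfl fun j _ => ?_)
    rw [mul_right_comm, Complex.mul_conj, ← Complex.ofReal_mul, Complex.ofReal_re]
  calc ∑ i, hA.1.eigenvalues i ^ t
      ≤ ∑ i, ∑ j, Complex.normSq (W i j) * hB.1.eigenvalues j ^ t := by
        refine Finset.sum_le_sum fun i _ => ?_
        refine (Real.rpow_le_rpow (hA.eigenvalues_nonneg i) (hdiag i) (by positivity)).trans ?_
        exact Real.rpow_arith_mean_le_arith_mean_rpow _ _ _ (fun j _ => Complex.normSq_nonneg _)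
          (hrow i) (fun j _ => hB.eigenvalues_nonneg j) ht
    _ = ∑ j, hB.1.eigenvalues j ^ t := by
        rw [Finset.sum_comm]
        refine Finset.sum_congr rfl fun j _ => ?_
        rw [← Finset.sum_mul, hcol, one_mul]

lemma trace_matPow_le (hA : A.PosSemidef) (hAB : A ≤ B) {t : ℝ} (ht : 0 < t) :
    (matPow A t).trace.re ≤ (matPow B t).trace.re := by
  rcases le_total t 1 with h | h
  · exact trace_re_le_trace_re (matPow_le_matPow hA hAB ht h)
  · exact trace_matPow_le_of_one_le hA hAB h

lemma trace_matPow_conjTranspose_mul_comm (X : Matrix m m ℂ) (t : ℝ) :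
    (matPow (X * Xᴴ) t).trace.re = (matPow (Xᴴ * X) t).trace.re := by
  have h1 := (posSemidef_self_mul_conjTranspose X).1
  have h2 := (posSemidef_conjTranspose_mul_self X).1
  rw [trace_matPow h1, trace_matPow h2,
    (IsHermitian.eigenvalues_eq_eigenvalues_iff h1 h2).2 (charpoly_mul_comm _ _)]

omit [DecidableEq m] in
lemma conj_le_conj (hAB : A ≤ B) (C : Matrix m m ℂ) : Cᴴ * A * C ≤ Cᴴ * B * C := by
  rw [le_iff, ← sub_mul, ← mul_sub]
  exact PosSemidef.conjTranspose_mul_mul_same hAB C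

/-- Operator antitonicity of regularised negative powers. -/
lemma cfc_add_rpow_neg_le (hA : A.PosSemidef) (hAB : A ≤ B) {p : ℝ} (hp : 0 ≤ p) (hp1 : p ≤ 1)
    {ε : ℝ} (hε : 0 < ε) :
    cfc (fun x : ℝ => (x + ε) ^ (-p)) B ≤ cfc (fun x : ℝ => (x + ε) ^ (-p)) A := by
  have hB : B.PosSemidef := (hA.nonneg.trans hAB).posSemidef
  have hpos {X : Matrix m m ℂ} (hX : X.PosSemidef) :
      IsStrictlyPositive (X + algebraMap ℝ _ ε) :=
    IsStrictlyPositive.nonneg_add hX.nonneg (isStrictlyPositive_algebraMap hε)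
  have key {X : Matrix m m ℂ} (hX : X.PosSemidef) :
      cfc (fun x : ℝ => (x + ε) ^ (-p)) X = ((X + algebraMap ℝ _ ε) ^ (-1 : ℝ)) ^ p := by
    rw [CFC.rpow_rpow _ _ _ (by norm_num) (hpos hX), neg_one_mul,
      CFC.rpow_eq_cfc_real (hpos hX).nonneg]
    have : X + algebraMap ℝ _ ε = cfc (fun x : ℝ => x + ε) X := by
      rw [cfc_add_const ε (fun x : ℝ => x) X (continuousOn_spectrum X _)
        hX.1.isSelfAdjoint, cfc_id' ℝ X hX.1.isSelfAdjoint]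
    rw [this, ← cfc_comp' (fun x : ℝ => x ^ (-p)) (fun x : ℝ => x + ε) X
      ((X.finite_real_spectrum.image _).continuousOn _) (continuousOn_spectrum X _)
      hX.1.isSelfAdjoint]
  rw [key hA, key hB]
  exact CFC.rpow_le_rpow ⟨hp, hp1⟩
    (CStarAlgebra.rpow_neg_one_le_rpow_neg_one (by gcongr) (hpos hA))

/-- The spectral projection of `X` onto its kernel. -/
noncomputable def kernelProj (X : Matrix m m ℂ) : Matrix m m ℂ :=
  cfc (fun x : ℝ => if x = 0 then 1 else 0) X

lemma mul_kernelProj {X : Matrix m m ℂ} (hX : X.IsHermitian) : X * kernelProj X = 0 := by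
  have h : X * kernelProj X = cfc (fun x : ℝ => x * if x = 0 then 1 else 0) X := by
    rw [cfc_mul _ _ X (continuousOn_spectrum X _) (continuousOn_spectrum X _)]
    change _ = cfc (fun x : ℝ => x) X * kernelProj X
    rw [cfc_id' ℝ X hX.isSelfAdjoint]
  rw [h, ← cfc_const_zero ℝ X]
  exact cfc_congr fun x _ => by by_cases hx : x = 0 <;> simp [hx]

lemma mul_kernelProj_of_dominates {X C : Matrix m m ℂ} (hX : X.IsHermitian)
    (h : dominates X (Cᴴ * C)) : C * kernelProj X = 0 := by
  have h0 : Cᴴ * C * kernelProj X = 0 := by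
    ext i j
    have hz : X *ᵥ (kernelProj X).col j = 0 := by
      funext k
      exact congrFun (congrFun (mul_kernelProj hX) k) j
    exact congrFun (h _ hz) i
  rw [← conjTranspose_mul_self_eq_zero, conjTranspose_mul, mul_assoc, ← mul_assoc Cᴴ, h0,
    mul_zero]

lemma tendsto_conj_cfc_add_rpow {X C : Matrix m m ℂ} (hX : X.PosSemidef)
    (h : dominates X (C * Cᴴ)) (t : ℝ) :
    Filter.Tendsto (fun ε : ℝ => Cᴴ * cfc (fun x : ℝ => (x + ε) ^ t) X * C) (𝓝[>] 0)
      (𝓝 (Cᴴ * matPow X t * C)) := by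
  have hK : kernelProj X * C = 0 := by
    have h1 : Cᴴ * kernelProj X = 0 :=
      mul_kernelProj_of_dominates hX.1 (by simpa using h)
    have h2 : (kernelProj X)ᴴ = kernelProj X := cfc_predicate (p := IsSelfAdjoint) _ X
    rw [← h2, ← conjTranspose_conjTranspose C, ← conjTranspose_mul, h1, conjTranspose_zero]
  have hsplit (ε : ℝ) : Cᴴ * cfc (fun x : ℝ => (x + ε) ^ t) X * C =
      Cᴴ * cfc (fun x : ℝ => if x = 0 then 0 else (x + ε) ^ t) X * C := by
    have : cfc (fun x : ℝ => (x + ε) ^ t) X =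
        cfc (fun x : ℝ => if x = 0 then 0 else (x + ε) ^ t) X + ε ^ t • kernelProj X := by
      rw [kernelProj, ← cfc_smul _ _ X (continuousOn_spectrum X _),
        ← cfc_add X _ _ (continuousOn_spectrum X _) (continuousOn_spectrum X _)]
      exact cfc_congr fun x _ => by by_cases hx : x = 0 <;> simp [hx]
    rw [this, mul_add, add_mul, mul_assoc _ (_ • _), smul_mul_assoc, hK, smul_zero, mul_zero,
      add_zero]
  simp only [hsplit]
  refine Filter.Tendsto.mono_left ?_ nhdsWithin_le_nhds
  rw [matPow_eq_cfc hX.1]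
  simp only [hX.1.cfc_eq, IsHermitian.cfc, Unitary.conjStarAlgAut_apply]
  refine ((Filter.Tendsto.mul_const _ (Filter.Tendsto.const_mul _ ?_)).const_mul _).mul_const _
  refine ((continuous_id.matrix_diagonal).tendsto _).comp (tendsto_pi_nhds.2 fun i => ?_)
  refine (Complex.continuous_ofReal.tendsto _).comp ?_
  simp only [Function.comp_apply, suppRpow]
  split_ifs with hi
  · exact tendsto_const_nhds
  · have hc : ContinuousAt (fun ε : ℝ => (hX.1.eigenvalues i + ε) ^ t) 0 :=
      ContinuousAt.rpow_const (by fun_prop) (Or.inl (by simpa using hi))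
    simpa [ContinuousAt] using hc

lemma conj_matPow_neg_le (hA : A.PosSemidef) (hAB : A ≤ B) {C : Matrix m m ℂ}
    (hAC : dominates A (C * Cᴴ)) (hBC : dominates B (C * Cᴴ)) {t : ℝ} (ht : -1 ≤ t)
    (ht0 : t ≤ 0) : Cᴴ * matPow B t * C ≤ Cᴴ * matPow A t * C := by
  have hB : B.PosSemidef := (hA.nonneg.trans hAB).posSemidef
  refine le_of_tendsto_of_tendsto (tendsto_conj_cfc_add_rpow hB hBC t)
    (tendsto_conj_cfc_add_rpow hA hAC t) ?_
  filter_upwards [self_mem_nhdsWithin] with ε hε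
  have := cfc_add_rpow_neg_le hA hAB (p := -t) (by linarith) (by linarith) hε
  rw [neg_neg] at this
  exact conj_le_conj this C

omit [DecidableEq m] in
lemma dominates_of_le (hA : A.PosSemidef) (hAB : A ≤ B) : dominates B A := by
  intro v hv
  rw [← hA.dotProduct_mulVec_zero_iff]
  have h := PosSemidef.dotProduct_mulVec_nonneg (M := B - A) hAB v
  rw [sub_mulVec, hv, zero_sub, dotProduct_neg, neg_nonneg] at h
  exact le_antisymm h (hA.dotProduct_mulVec_nonneg v)

end MatrixPowers

section SandwichedTrace

variable {m : Type*} [Fintype m] [DecidableEq m] {ρ σ : Matrix m m ℂ}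

lemma trace_sandwiched_eq (hρ : ρ.PosSemidef) (hσ : σ.PosSemidef) (s α : ℝ) :
    (matPow (matPow σ s * ρ * matPow σ s) α).trace.re =
      (matPow ((matPow ρ (1 / 2))ᴴ * matPow σ (2 * s) * matPow ρ (1 / 2)) α).trace.re := by
  have hR : (matPow ρ (1 / 2))ᴴ = matPow ρ (1 / 2) := (posSemidef_matPow hρ _).1
  have hS : (matPow σ s)ᴴ = matPow σ s := (posSemidef_matPow hσ _).1
  have h := trace_matPow_conjTranspose_mul_comm (matPow σ s * matPow ρ (1 / 2)) α
  rw [conjTranspose_mul, hR, hS] at h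
  rw [hR, two_mul, ← matPow_mul_matPow hσ]
  have hρ2 : ρ = matPow ρ (1 / 2) * matPow ρ (1 / 2) := by
    rw [matPow_mul_matPow hρ, add_halves, matPow_one hρ.1]
  conv_lhs => rw [hρ2]
  simpa only [mul_assoc] using h

lemma trace_sandwiched_self (hρ : ρ.PosSemidef) {s α : ℝ} (h : (1 + 2 * s) * α = 1) :
    (matPow ((matPow ρ (1 / 2))ᴴ * matPow ρ (2 * s) * matPow ρ (1 / 2)) α).trace.re =
      ρ.trace.re := by
  have hR : (matPow ρ (1 / 2))ᴴ = matPow ρ (1 / 2) := (posSemidef_matPow hρ _).1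
  rw [hR, matPow_mul_matPow hρ, matPow_mul_matPow hρ, matPow_matPow hρ,
    show (1 / 2 + 2 * s + 1 / 2) * α = 1 by linarith, matPow_one hρ.1]

lemma posSemidef_conj_matPow (hσ : σ.PosSemidef) (t : ℝ) (C : Matrix m m ℂ) :
    (Cᴴ * matPow σ t * C).PosSemidef :=
  (posSemidef_matPow hσ t).conjTranspose_mul_mul_same C

lemma matPow_half_mul_conjTranspose (hρ : ρ.PosSemidef) :
    matPow ρ (1 / 2) * (matPow ρ (1 / 2))ᴴ = ρ := by
  rw [(posSemidef_matPow hρ _).1, matPow_mul_matPow hρ, add_halves, matPow_one hρ.1]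

omit [DecidableEq m] in
lemma trace_re_pos (hρ : ρ.PosSemidef) (hρ0 : ρ ≠ 0) : 0 < ρ.trace.re := by
  have h := Complex.le_def.1 hρ.trace_nonneg
  refine lt_of_le_of_ne h.1 fun h0 => hρ0 (hρ.trace_eq_zero_iff.1 ?_)
  exact Complex.ext h0.symm h.2.symm

lemma trace_mul_ne_zero_of_le (hρ : ρ.PosSemidef) (hρ0 : ρ ≠ 0) (h : ρ ≤ σ) :
    (ρ * σ).trace ≠ 0 := by
  intro h0
  set R := matPow ρ (1 / 2)
  have hR : Rᴴ = R := (posSemidef_matPow hρ _).1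
  have hRR : R * R = ρ := by
    simpa only [R, hR] using matPow_half_mul_conjTranspose hρ
  have hle := trace_re_le_trace_re (conj_le_conj h R)
  have hcyc (X : Matrix m m ℂ) : (Rᴴ * X * R).trace = (ρ * X).trace := by
    rw [hR, trace_mul_cycle, hRR]
  rw [hcyc, hcyc, h0, Complex.zero_re] at hle
  have hρρ : (ρᴴ * ρ).PosSemidef := posSemidef_conjTranspose_mul_self ρ
  refine hle.not_gt ?_
  rw [hρ.1] at hρρ
  refine trace_re_pos hρρ fun hz => hρ0 ?_
  rw [← conjTranspose_mul_self_eq_zero, hρ.1, hz]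

end SandwichedTrace

/-- order property of the sandwiched Rényi divergence. -/
theorem stmt0 {n : ℕ} (hn : 1 ≤ n) {α : ℝ}
    (hα : (1 / 2 ≤ α ∧ α < 1) ∨ 1 < α)
    {ρ σ : Matrix (Fin n) (Fin n) ℂ}
    (hρ : ρ.PosSemidef) (hσ : σ.PosSemidef) (hρ0 : ρ ≠ 0) :
    ((ρ - σ).PosSemidef → 0 ≤ Dtilde α ρ σ) ∧
    ((σ - ρ).PosSemidef → Dtilde α ρ σ ≤ 0) := by
  have hα0 : 0 < α := by rcases hα with h | h <;> linarith
  have hpos := trace_re_pos hρ hρ0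
  set s := (1 - α) / (2 * α) with hs
  have hsα : (1 + 2 * s) * α = 1 := by rw [hs]; field_simp; ring
  have hself : dominates ρ ρ := fun _ hv => hv
  have hC := matPow_half_mul_conjTranspose hρ
  have hQ0 : 0 ≤ (matPow (matPow σ s * ρ * matPow σ s) α).trace.re := by
    rw [trace_sandwiched_eq hρ hσ]
    exact (Complex.le_def.1
      (posSemidef_matPow (posSemidef_conj_matPow hσ _ _) α).trace_nonneg).1
  constructor
  · intro hle
    unfold Dtilde
    split_ifs with hcond
    · rw [← hs]
      norm_cast
      rcases hα with ⟨hα1, hα2⟩ | hα1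
      · have hs0 : 0 < 2 * s := by rw [hs]; have := sub_pos.2 hα2; positivity
        have hs1 : 2 * s ≤ 1 := by
          rw [hs, ← mul_div_assoc, div_le_one (by positivity)]; linarith
        refine mul_nonneg_of_nonpos_of_nonpos (inv_nonpos.2 (by linarith)) ?_
        refine Real.logb_nonpos one_lt_two (div_nonneg hQ0 hpos.le) ((div_le_one hpos).2 ?_)
        rw [trace_sandwiched_eq hρ hσ, ← trace_sandwiched_self hρ hsα]
        exact trace_matPow_le (posSemidef_conj_matPow hσ _ _)
          (conj_le_conj (matPow_le_matPow hσ hle hs0 hs1) _) hα0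
      · have hdom : dominates σ ρ := hcond.2.resolve_right hα1.not_gt
        have hs0 : 2 * s ≤ 0 := by nlinarith
        have hs1 : -1 ≤ 2 * s := by nlinarith
        refine mul_nonneg (inv_nonneg.2 (by linarith)) ?_
        refine Real.logb_nonneg one_lt_two ((one_le_div hpos).2 ?_)
        rw [trace_sandwiched_eq hρ hσ, ← trace_sandwiched_self hρ hsα]
        refine trace_matPow_le (posSemidef_conj_matPow hρ _ _)
          (conj_matPow_neg_le hσ hle ?_ ?_ hs1 hs0) hα0 <;> rwa [hC]
    · exact le_top
  · intro hle
    have hdom : dominates σ ρ := dominates_of_le hρ hle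
    unfold Dtilde
    rw [if_pos ⟨trace_mul_ne_zero_of_le hρ hρ0 hle, Or.inl hdom⟩, ← hs]
    norm_cast
    rcases hα with ⟨hα1, hα2⟩ | hα1
    · have hs0 : 0 < 2 * s := by rw [hs]; have := sub_pos.2 hα2; positivity
      have hs1 : 2 * s ≤ 1 := by
        rw [hs, ← mul_div_assoc, div_le_one (by positivity)]; linarith
      refine mul_nonpos_of_nonpos_of_nonneg (inv_nonpos.2 (by linarith)) ?_
      refine Real.logb_nonneg one_lt_two ((one_le_div hpos).2 ?_)
      rw [trace_sandwiched_eq hρ hσ, ← trace_sandwiched_self hρ hsα]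
      exact trace_matPow_le (posSemidef_conj_matPow hρ _ _)
        (conj_le_conj (matPow_le_matPow hρ hle hs0 hs1) _) hα0
    · have hs0 : 2 * s ≤ 0 := by nlinarith
      have hs1 : -1 ≤ 2 * s := by nlinarith
      refine mul_nonpos_of_nonneg_of_nonpos (inv_nonneg.2 (by linarith)) ?_
      refine Real.logb_nonpos one_lt_two (div_nonneg hQ0 hpos.le) ((div_le_one hpos).2 ?_)
      rw [trace_sandwiched_eq hρ hσ, ← trace_sandwiched_self hρ hsα]
      refine trace_matPow_le (posSemidef_conj_matPow hσ _ _)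
        (conj_matPow_neg_le hρ hle ?_ ?_ hs1 hs0) hα0 <;> rwa [hC]
end

section
/- Let α ∈ (1, 2], let ρ, σ be positive semidefinite complex n×n matrices with ρ ≠ 0, and let E be the completely positive trace-preserving map given in Kraus form E(X) = ∑_i K_i X K_i†, where the K_i are complex m×n matrices satisfying ∑_i K_i† K_i = I_n. Then D̃_α(E(ρ) ‖ E(σ)) ≤ D̃_α(ρ‖σ) in ℝ ∪ {+∞}. -/
open Matrix
open scoped Kronecker Classical ComplexOrder

/-- Complex power of a Hermitian matrix, taken on the support: the eigenvalue `0` is mapped to `0`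
and a nonzero eigenvalue `x` to `exp (z * log x)`. Non-Hermitian matrices are mapped to `0`. -/
noncomputable def suppPow {n : Type*} [Fintype n] [DecidableEq n]
    (A : Matrix n n ℂ) (z : ℂ) : Matrix n n ℂ :=
  if hA : A.IsHermitian then
    (hA.eigenvectorUnitary : Matrix n n ℂ) *
      Matrix.diagonal (fun i =>
        if hA.eigenvalues i = 0 then 0 else Complex.exp (z * Real.log (hA.eigenvalues i))) *
      (star (hA.eigenvectorUnitary : Matrix n n ℂ))
  else 0

section SuppPow

variable {n : Type*} [Fintype n] [DecidableEq n] {A : Matrix n n ℂ}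

theorem suppPow_add (hA : A.IsHermitian) (z w : ℂ) :
    suppPow A (z + w) = suppPow A z * suppPow A w := by
  simp only [suppPow, dif_pos hA]
  set U : Matrix n n ℂ := (hA.eigenvectorUnitary : Matrix n n ℂ) with hU
  have hUU : star U * U = 1 := Unitary.coe_star_mul_self hA.eigenvectorUnitary
  have h : ∀ D E : Matrix n n ℂ, U * D * star U * (U * E * star U) = U * (D * E) * star U := by
    intro D E
    calc _ = U * D * (star U * U) * E * star U := by simp only [mul_assoc]
      _ = _ := by rw [hUU]; simp only [mul_assoc, one_mul]
  rw [h, diagonal_mul_diagonal]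
  congr 3
  ext i
  split_ifs
  · simp
  · rw [add_mul, Complex.exp_add]

theorem suppPow_conjTranspose (hA : A.IsHermitian) (z : ℂ) :
    (suppPow A z)ᴴ = suppPow A (star z) := by
  simp only [suppPow, dif_pos hA, conjTranspose_mul, diagonal_conjTranspose, star_eq_conjTranspose,
    conjTranspose_conjTranspose, mul_assoc]
  congr 3
  ext i
  simp only [Pi.star_apply]
  split_ifs
  · simp
  · simp [← Complex.exp_conj]

theorem suppPow_one (hA : A.IsHermitian) (h : A.PosSemidef) : suppPow A 1 = A := by
  conv_rhs => rw [hA.spectral_theorem]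
  simp only [suppPow, dif_pos hA, Unitary.conjStarAlgAut_apply]
  congr 3
  ext i
  have := h.eigenvalues_nonneg i
  split_ifs with h0
  · simp [h0]
  · rw [one_mul, ← Complex.ofReal_exp, Real.exp_log (lt_of_le_of_ne this (Ne.symm h0))]
    simp

theorem matPow_eq_suppPow (h : A.PosSemidef) (t : ℝ) : matPow A t = suppPow A t := by
  simp only [suppPow, matPow, dif_pos h.1]
  congr 3
  ext i
  have := h.eigenvalues_nonneg i
  split_ifs with h0
  · simp
  · rw [Real.rpow_def_of_pos (lt_of_le_of_ne this (Ne.symm h0)), mul_comm]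
    simp

theorem suppPow_zero_isHermitian (hA : A.IsHermitian) : (suppPow A 0)ᴴ = suppPow A 0 := by
  rw [suppPow_conjTranspose hA, star_zero]

theorem suppPow_zero_mul_self (hA : A.IsHermitian) : suppPow A 0 * suppPow A 0 = suppPow A 0 := by
  rw [← suppPow_add hA, add_zero]

end SuppPow

/-- The squared Frobenius norm of a matrix, as a trace. -/
noncomputable def frobSq {m n : Type*} [Fintype m] [Fintype n] (X : Matrix m n ℂ) : ℝ :=
  (Xᴴ * X).trace.re

section FrobSq

variable {l m n : Type*} [Fintype l] [Fintype m] [Fintype n]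

theorem frobSq_nonneg (X : Matrix m n ℂ) : 0 ≤ frobSq X :=
  (Complex.le_def.1 (posSemidef_conjTranspose_mul_self X).trace_nonneg).1

theorem frobSq_conjTranspose (X : Matrix m n ℂ) : frobSq Xᴴ = frobSq X := by
  rw [frobSq, conjTranspose_conjTranspose, trace_mul_comm, frobSq]

theorem frobSq_eq_sum (X : Matrix m n ℂ) : frobSq X = ∑ j, ∑ i, ‖X i j‖ ^ 2 := by
  simp only [frobSq, trace, diag, mul_apply, conjTranspose_apply, Complex.re_sum]
  refine Finset.sum_congr rfl fun j _ => Finset.sum_congr rfl fun i _ => ?_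
  rw [Complex.star_def, ← Complex.normSq_eq_conj_mul_self, Complex.ofReal_re,
    Complex.normSq_eq_norm_sq]

theorem norm_trace_mul_le (X : Matrix m n ℂ) (Z : Matrix n m ℂ) :
    ‖(X * Z).trace‖ ≤ (frobSq X + frobSq Z) / 2 := by
  rw [← frobSq_conjTranspose X, frobSq_eq_sum, frobSq_eq_sum, ← Finset.sum_add_distrib,
    Finset.sum_div]
  simp only [trace, diag, mul_apply, conjTranspose_apply, norm_star]
  refine (norm_sum_le _ _).trans (Finset.sum_le_sum fun i _ => ?_)
  rw [← Finset.sum_add_distrib, Finset.sum_div]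
  refine (norm_sum_le _ _).trans (Finset.sum_le_sum fun j _ => ?_)
  rw [norm_mul]
  nlinarith [sq_nonneg (‖X i j‖ - ‖Z j i‖)]

theorem frobSq_mul_le_of_projection [DecidableEq m] {C P : Matrix m m ℂ} (hC : Cᴴ * C = P)
    (hP : Pᴴ = P) (hPP : P * P = P) (X : Matrix m n ℂ) : frobSq (C * X) ≤ frobSq X := by
  have h1 : (C * X)ᴴ * (C * X) = Xᴴ * P * X := by
    rw [conjTranspose_mul, ← hC]; simp only [Matrix.mul_assoc]
  have h2 : ((1 - P) * X)ᴴ * ((1 - P) * X) = Xᴴ * X - Xᴴ * P * X := by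
    have h3 : (1 - P) * (1 - P) = 1 - P := by
      simp only [sub_mul, mul_sub, hPP, one_mul, mul_one, sub_self, sub_zero]
    calc _ = Xᴴ * ((1 - P) * (1 - P)) * X := by
          rw [conjTranspose_mul, conjTranspose_sub, hP, conjTranspose_one]
          simp only [Matrix.mul_assoc]
      _ = _ := by rw [h3, Matrix.mul_sub, Matrix.sub_mul, Matrix.mul_one]
  have h4 := frobSq_nonneg ((1 - P) * X)
  rw [frobSq, h2, trace_sub, Complex.sub_re] at h4
  rw [frobSq, h1, frobSq]
  linarith

theorem sum_frobSq_mul {ι : Type*} [Fintype ι] [DecidableEq n] {K : ι → Matrix m n ℂ}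
    (hK : ∑ i, (K i)ᴴ * K i = 1) (X : Matrix n l ℂ) : ∑ i, frobSq (K i * X) = frobSq X := by
  simp only [frobSq]
  rw [← Complex.re_sum, ← trace_sum]
  congr 2
  calc _ = Xᴴ * (∑ i, (K i)ᴴ * K i) * X := by
        simp only [conjTranspose_mul, Matrix.mul_assoc, Matrix.mul_sum, Matrix.sum_mul]
    _ = _ := by rw [hK, Matrix.mul_one]

theorem frobSq_suppPow [DecidableEq n] {A : Matrix n n ℂ} (hA : A.IsHermitian) (z : ℂ) :
    frobSq (suppPow A z) = (suppPow A ((2 * z.re : ℝ) : ℂ)).trace.re := by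
  rw [frobSq, suppPow_conjTranspose hA, ← suppPow_add hA, add_comm, Complex.star_def,
    Complex.add_conj]

theorem frobSq_suppPow_mul_le [DecidableEq m] {A : Matrix m m ℂ} (hA : A.IsHermitian) {z : ℂ}
    (hz : z.re = 0) (X : Matrix m n ℂ) : frobSq (suppPow A z * X) ≤ frobSq X := by
  refine frobSq_mul_le_of_projection (P := suppPow A 0) ?_ (suppPow_zero_isHermitian hA)
    (suppPow_zero_mul_self hA) X
  rw [suppPow_conjTranspose hA, ← suppPow_add hA, add_comm, Complex.star_def, Complex.add_conj, hz]
  simp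

end FrobSq

section Kraus

variable {ι m n : Type*} [Fintype ι] [Fintype m] [Fintype n] {K : ι → Matrix m n ℂ}

theorem posSemidef_sum_mul_mul_conjTranspose {X : Matrix n n ℂ} (hX : X.PosSemidef) :
    (∑ i, K i * X * (K i)ᴴ).PosSemidef :=
  posSemidef_sum _ fun i _ => hX.mul_mul_conjTranspose_same (K i)

theorem trace_sum_mul_mul_conjTranspose [DecidableEq n]
    (hK : ∑ i, (K i)ᴴ * K i = 1) (X : Matrix n n ℂ) :
    (∑ i, K i * X * (K i)ᴴ).trace = X.trace := by
  rw [trace_sum]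
  have : ∀ i, (K i * X * (K i)ᴴ).trace = ((K i)ᴴ * K i * X).trace := fun i => by
    rw [trace_mul_comm, Matrix.mul_assoc]
  simp only [this]
  rw [← trace_sum, ← Matrix.sum_mul, hK, Matrix.one_mul]

variable [DecidableEq m] [DecidableEq n]

theorem sum_frobSq_le_of_re_eq_zero (hK : ∑ i, (K i)ᴴ * K i = 1) {σ A : Matrix n n ℂ}
    {τ B : Matrix m m ℂ} (hσ : σ.IsHermitian) (hτ : τ.IsHermitian) (hA : A.IsHermitian)
    (hB : B.IsHermitian) {s t b : ℂ} (hs : s.re = 0) (ht : t.re = 0) (hb : b.re = 0) (a : ℂ) :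
    ∑ i, frobSq (suppPow B b * (suppPow τ t * (K i * (suppPow σ s * suppPow A a)))) ≤
      (suppPow A ((2 * a.re : ℝ) : ℂ)).trace.re := by
  rw [← frobSq_suppPow hA]
  refine le_trans (Finset.sum_le_sum fun i _ => (frobSq_suppPow_mul_le hB hb _).trans
    (frobSq_suppPow_mul_le hτ ht _)) ?_
  rw [sum_frobSq_mul hK]
  exact frobSq_suppPow_mul_le hσ hs _

theorem sum_frobSq_le_of_re_eq_half {σ A : Matrix n n ℂ} {τ B : Matrix m m ℂ}
    (hσ : σ.PosSemidef) (hτ : τ = ∑ i, K i * σ * (K i)ᴴ) (hA : A.IsHermitian)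
    (hB : B.IsHermitian) {s t a : ℂ} (hs : s.re = 1 / 2) (ht : t.re = -(1 / 2)) (ha : a.re = 0)
    (b : ℂ) :
    ∑ i, frobSq (suppPow A a * (suppPow σ s * ((K i)ᴴ * (suppPow τ t * suppPow B b)))) ≤
      (suppPow B ((2 * b.re : ℝ) : ℂ)).trace.re := by
  have hτp : τ.PosSemidef := hτ ▸ posSemidef_sum_mul_mul_conjTranspose hσ
  rw [← frobSq_suppPow hB]
  refine le_trans (Finset.sum_le_sum fun i _ => frobSq_suppPow_mul_le hA ha _) ?_
  set Y := suppPow τ t * suppPow B b with hY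
  have hss : (suppPow σ s)ᴴ * suppPow σ s = σ := by
    rw [suppPow_conjTranspose hσ.1, ← suppPow_add hσ.1, add_comm, Complex.star_def,
      Complex.add_conj, hs]
    norm_num [suppPow_one hσ.1 hσ]
  have hττ : (suppPow τ (1 / 2))ᴴ * suppPow τ (1 / 2) = τ := by
    rw [suppPow_conjTranspose hτp.1, ← suppPow_add hτp.1, add_comm, Complex.star_def,
      Complex.add_conj]
    norm_num [suppPow_one hτp.1 hτp]
  have h : ∑ i, frobSq (suppPow σ s * ((K i)ᴴ * Y)) = frobSq (suppPow τ (1 / 2) * Y) := by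
    simp only [frobSq]
    rw [← Complex.re_sum, ← trace_sum]
    congr 2
    calc _ = Yᴴ * (∑ i, K i * ((suppPow σ s)ᴴ * suppPow σ s) * (K i)ᴴ) * Y := by
          simp only [conjTranspose_mul, conjTranspose_conjTranspose, Matrix.mul_assoc,
            Matrix.mul_sum, Matrix.sum_mul]
      _ = Yᴴ * ((suppPow τ (1 / 2))ᴴ * suppPow τ (1 / 2)) * Y := by rw [hss, hττ, hτ]
      _ = _ := by simp only [conjTranspose_mul, Matrix.mul_assoc]
  rw [h, hY, ← Matrix.mul_assoc, ← suppPow_add hτp.1]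
  refine frobSq_suppPow_mul_le hτp.1 ?_ _
  rw [Complex.add_re, ht]
  norm_num

end Kraus

/-- The entries of a matrix-valued function are entire, and bounded on `0 ≤ re z ≤ 1`. -/
def EntireBddOnStrip {m n : Type*} (M : ℂ → Matrix m n ℂ) : Prop :=
  ∀ i j, Differentiable ℂ (fun z => M z i j) ∧
    ∃ C, ∀ z ∈ Complex.HadamardThreeLines.verticalClosedStrip 0 1, ‖M z i j‖ ≤ C

namespace EntireBddOnStrip

variable {l m n : Type*}

theorem const (X : Matrix m n ℂ) : EntireBddOnStrip fun _ => X := fun i j =>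
  ⟨differentiable_const _, ‖X i j‖, fun _ _ => le_rfl⟩

theorem mul [Fintype m] {M : ℂ → Matrix l m ℂ} {N : ℂ → Matrix m n ℂ} (hM : EntireBddOnStrip M)
    (hN : EntireBddOnStrip N) : EntireBddOnStrip fun z => M z * N z := by
  intro i j
  simp only [mul_apply]
  refine ⟨Differentiable.fun_sum fun k _ => (hM i k).1.mul (hN k j).1, ?_⟩
  choose C hC using fun k => (hM i k).2
  choose D hD using fun k => (hN k j).2
  refine ⟨∑ k, C k * D k, fun z hz => (norm_sum_le _ _).trans (Finset.sum_le_sum fun k _ => ?_)⟩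
  rw [norm_mul]
  exact mul_le_mul (hC k z hz) (hD k z hz) (norm_nonneg _) ((norm_nonneg _).trans (hC k z hz))

theorem suppPow [Fintype n] [DecidableEq n] (A : Matrix n n ℂ) (a b : ℝ) :
    EntireBddOnStrip fun z => suppPow A (a * z + b) := by
  by_cases hA : A.IsHermitian
  · simp only [_root_.suppPow, dif_pos hA]
    refine ((const _).mul ?_).mul (const _)
    intro i j
    by_cases hij : i = j
    · subst hij
      simp only [diagonal_apply_eq]
      split_ifs
      · exact ⟨differentiable_const _, 0, fun _ _ => by simp⟩
      · refine ⟨by fun_prop, Real.exp ((|a| + |b|) * |Real.log (hA.eigenvalues i)|),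
          fun z hz => ?_⟩
        obtain ⟨h0, h1⟩ : 0 ≤ z.re ∧ z.re ≤ 1 := hz
        rw [Complex.norm_exp, Real.exp_le_exp, Complex.re_mul_ofReal]
        refine (le_abs_self _).trans ?_
        rw [abs_mul]
        refine mul_le_mul_of_nonneg_right ?_ (abs_nonneg _)
        simp only [Complex.add_re, Complex.re_ofReal_mul, Complex.ofReal_re]
        refine (abs_add_le _ _).trans (add_le_add_left ?_ _)
        rw [abs_mul, abs_of_nonneg h0]
        exact mul_le_of_le_one_right (abs_nonneg _) h1
    · simp only [diagonal_apply_ne _ hij]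
      exact ⟨differentiable_const _, 0, fun _ _ => by simp⟩
  · simp only [_root_.suppPow, dif_neg hA]
    exact const 0

theorem differentiable_trace [Fintype n] {M : ℂ → Matrix n n ℂ} (hM : EntireBddOnStrip M) :
    Differentiable ℂ fun z => (M z).trace := by
  simp only [trace, diag]
  exact Differentiable.fun_sum fun i _ => (hM i i).1

theorem exists_norm_trace_le [Fintype n] {M : ℂ → Matrix n n ℂ} (hM : EntireBddOnStrip M) :
    ∃ C, ∀ z ∈ Complex.HadamardThreeLines.verticalClosedStrip 0 1, ‖(M z).trace‖ ≤ C := by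
  choose C hC using fun i => (hM i i).2
  exact ⟨∑ i, C i, fun z hz => (norm_sum_le _ _).trans (Finset.sum_le_sum fun i _ => hC i z hz)⟩

end EntireBddOnStrip

section DataProcessing

variable {m n : Type*} [Fintype m] [Fintype n]

theorem suppPow_zero_mul_of_dominates [DecidableEq n] {ρ σ : Matrix n n ℂ} (hσ : σ.PosSemidef)
    (hρ : ρ.IsHermitian) (h : dominates σ ρ) : ρ * suppPow σ 0 = ρ ∧ suppPow σ 0 * ρ = ρ := by
  have h1 : σ * (1 - suppPow σ 0) = 0 := by
    have : σ * suppPow σ 0 = σ := by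
      have h0 := suppPow_add hσ.1 1 0
      rwa [add_zero, suppPow_one hσ.1 hσ, eq_comm] at h0
    rw [mul_sub, this, mul_one, sub_self]
  have h2 : ρ * (1 - suppPow σ 0) = 0 := by
    ext i j
    have := h (fun k => (1 - suppPow σ 0) k j) (funext fun i => congr_fun (congr_fun h1 i) j)
    exact congr_fun this i
  have h3 : ρ * suppPow σ 0 = ρ := by
    rw [mul_sub, mul_one, sub_eq_zero] at h2
    exact h2.symm
  refine ⟨h3, ?_⟩
  have := congr_arg conjTranspose h3
  rwa [conjTranspose_mul, suppPow_zero_isHermitian hσ.1, hρ.eq] at this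

theorem eq_zero_of_dominates_of_trace_mul_eq_zero [DecidableEq n] {ρ σ : Matrix n n ℂ}
    (hρ : ρ.PosSemidef) (hσ : σ.PosSemidef) (h : dominates σ ρ) (h0 : (ρ * σ).trace = 0) :
    ρ = 0 := by
  have hsq : ∀ {A : Matrix n n ℂ}, A.PosSemidef →
      A = suppPow A (1 / 2 : ℂ) * suppPow A (1 / 2 : ℂ) ∧
        (suppPow A (1 / 2 : ℂ))ᴴ = suppPow A (1 / 2 : ℂ) := by
    intro A hA
    rw [← suppPow_add hA.1, suppPow_conjTranspose hA.1]
    norm_num [suppPow_one hA.1 hA]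
  obtain ⟨hρ1, hρ2⟩ := hsq hρ
  obtain ⟨hσ1, hσ2⟩ := hsq hσ
  set R := suppPow ρ (1 / 2 : ℂ)
  set S := suppPow σ (1 / 2 : ℂ)
  have h1 : S * R = 0 := by
    rw [← trace_conjTranspose_mul_self_eq_zero_iff, ← h0, conjTranspose_mul, hρ2, hσ2, hρ1, hσ1]
    rw [trace_mul_comm]
    calc (S * R * (R * S)).trace = (S * (R * R * S)).trace := by simp only [mul_assoc]
      _ = _ := by rw [trace_mul_comm, mul_assoc]
  have h2 : σ * ρ = 0 := by
    rw [hρ1, hσ1]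
    calc S * S * (R * R) = S * (S * R) * R := by simp only [mul_assoc]
      _ = 0 := by rw [h1]; simp
  have h3 : ρᴴ * ρ = 0 := by
    rw [hρ.1.eq]
    ext i j
    exact congr_fun (h (fun k => ρ k j) (funext fun i => congr_fun (congr_fun h2 i) j)) i
  exact conjTranspose_mul_self_eq_zero.1 h3

theorem dominates_sum_mul_mul_conjTranspose {ι : Type*} [Fintype ι] {K : ι → Matrix m n ℂ}
    {ρ σ : Matrix n n ℂ} (hσ : σ.PosSemidef) (h : dominates σ ρ) :
    dominates (∑ i, K i * σ * (K i)ᴴ) (∑ i, K i * ρ * (K i)ᴴ) := by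
  intro v hv
  have hnn : ∀ i, 0 ≤ star v ⬝ᵥ ((K i * σ * (K i)ᴴ) *ᵥ v) := fun i =>
    (hσ.mul_mul_conjTranspose_same (K i)).dotProduct_mulVec_nonneg v
  have hsum : ∑ i, star v ⬝ᵥ ((K i * σ * (K i)ᴴ) *ᵥ v) = 0 := by
    rw [← dotProduct_sum, ← sum_mulVec, hv, dotProduct_zero]
  have hz := (Finset.sum_eq_zero_iff_of_nonneg fun i _ => hnn i).1 hsum
  rw [sum_mulVec]
  refine Finset.sum_eq_zero fun i _ => ?_
  have h1 : star ((K i)ᴴ *ᵥ v) ⬝ᵥ (σ *ᵥ ((K i)ᴴ *ᵥ v)) = 0 := by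
    rw [← hz i (Finset.mem_univ i), star_mulVec, conjTranspose_conjTranspose,
      ← dotProduct_mulVec, mulVec_mulVec, mulVec_mulVec]
  rw [← mulVec_mulVec, ← mulVec_mulVec, h _ ((hσ.dotProduct_mulVec_zero_iff _).1 h1),
    mulVec_zero]

theorem posSemidef_suppPow_mul_mul_suppPow [DecidableEq n] {ρ σ : Matrix n n ℂ}
    (hρ : ρ.PosSemidef) (hσ : σ.IsHermitian) (s : ℝ) :
    (suppPow σ s * ρ * suppPow σ s).PosSemidef := by
  have := hρ.mul_mul_conjTranspose_same (suppPow σ s)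
  rwa [suppPow_conjTranspose hσ, Complex.star_def, Complex.conj_ofReal] at this

theorem posSemidef_suppPow [DecidableEq n] {A : Matrix n n ℂ} (hA : A.IsHermitian) (t : ℝ) :
    (suppPow A t).PosSemidef := by
  have := posSemidef_conjTranspose_mul_self (suppPow A ((t / 2 : ℝ) : ℂ))
  rw [suppPow_conjTranspose hA, ← suppPow_add hA, Complex.star_def, Complex.conj_ofReal,
    ← Complex.ofReal_add, add_halves] at this
  exact this

theorem trace_suppPow_sandwich_pos [DecidableEq n] {ρ σ : Matrix n n ℂ} (hρ : ρ.PosSemidef)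
    (hσ : σ.PosSemidef) (h : dominates σ ρ) (hρ0 : ρ ≠ 0) (s t : ℝ) :
    0 < (suppPow (suppPow σ s * ρ * suppPow σ s) t).trace.re := by
  have hA := posSemidef_suppPow_mul_mul_suppPow hρ hσ.1 s
  set A := suppPow σ s * ρ * suppPow σ s with hAdef
  have hAt := posSemidef_suppPow hA.1 t
  refine (Complex.lt_def.1 (lt_of_le_of_ne hAt.trace_nonneg (Ne.symm fun h0 => hρ0 ?_))).1
  have hA0 : A = 0 := by
    rw [← suppPow_one hA.1 hA, ← sub_add_cancel (1 : ℂ) t, suppPow_add hA.1,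
      hAt.trace_eq_zero_iff.1 h0, mul_zero]
  obtain ⟨hr, hl⟩ := suppPow_zero_mul_of_dominates hσ hρ.1 h
  calc ρ = suppPow σ (-s + s) * ρ * suppPow σ (s + -s) := by
        rw [neg_add_cancel, add_neg_cancel, hl, hr]
    _ = suppPow σ (-s) * A * suppPow σ (-s) := by
        rw [suppPow_add hσ.1, suppPow_add hσ.1, hAdef]; simp only [mul_assoc]
    _ = 0 := by rw [hA0]; simp

variable {ι : Type*} [Fintype ι] [DecidableEq m] [DecidableEq n] {K : ι → Matrix m n ℂ}

/-- Data processing for the trace functional of the sandwiched Rényi divergence, by three-lines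
interpolation between the trace norm at `re z = 0` and the operator norm at `re z = 1`. -/
theorem trace_suppPow_sandwich_le (hK : ∑ i, (K i)ᴴ * K i = 1) {p : ℝ} (hp : 1 < p)
    {ρ σ : Matrix n n ℂ} {ρ' σ' : Matrix m m ℂ} (hρ : ρ.PosSemidef) (hσ : σ.PosSemidef)
    (h : dominates σ ρ) (hρ' : ρ' = ∑ i, K i * ρ * (K i)ᴴ) (hσ' : σ' = ∑ i, K i * σ * (K i)ᴴ)
    {s : ℝ} (hs : s = (1 - p) / (2 * p)) :
    (suppPow (suppPow σ' s * ρ' * suppPow σ' s) p).trace.re ≤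
      (suppPow (suppPow σ s * ρ * suppPow σ s) p).trace.re := by
  have hp0 : 0 < p := by linarith
  have hρp : ρ'.PosSemidef := hρ' ▸ posSemidef_sum_mul_mul_conjTranspose hρ
  have hσp : σ'.PosSemidef := hσ' ▸ posSemidef_sum_mul_mul_conjTranspose hσ
  have hA := posSemidef_suppPow_mul_mul_suppPow hρ hσ.1 s
  have hB := posSemidef_suppPow_mul_mul_suppPow hρp hσp.1 s
  set A := suppPow σ s * ρ * suppPow σ s with hAdef
  set B := suppPow σ' s * ρ' * suppPow σ' s with hBdef
  set S : ℂ → Matrix n n ℂ := fun z => suppPow σ ((1 / 2 : ℝ) * z + (0 : ℝ)) with hS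
  set T : ℂ → Matrix m m ℂ := fun z => suppPow σ' ((-(1 / 2) : ℝ) * z + (0 : ℝ)) with hT
  set X : ℂ → Matrix n n ℂ := fun z => suppPow A ((-p : ℝ) * z + p) with hX
  set Y : ℂ → Matrix m m ℂ := fun z => suppPow B (p * z + (0 : ℝ)) with hY
  set g : ι → ℂ → Matrix m m ℂ :=
    fun i z => Y z * (T z * K i * S z * X z * S z * (K i)ᴴ * T z) with hg
  set f : ℂ → ℂ := fun z => ∑ i, (g i z).trace with hf
  set a := (suppPow A p).trace.re with ha
  set b := (suppPow B p).trace.re with hb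
  have ha0 : 0 ≤ a := (Complex.le_def.1 (posSemidef_suppPow hA.1 p).trace_nonneg).1
  have hb0 : 0 ≤ b := (Complex.le_def.1 (posSemidef_suppPow hB.1 p).trace_nonneg).1
  have hgE : ∀ i, EntireBddOnStrip (g i) := fun i =>
    (EntireBddOnStrip.suppPow B p 0).mul
      (((((((EntireBddOnStrip.suppPow σ' _ _).mul (.const (K i))).mul
        (EntireBddOnStrip.suppPow σ _ _)).mul (EntireBddOnStrip.suppPow A _ _)).mul
        (EntireBddOnStrip.suppPow σ _ _)).mul (.const (K i)ᴴ)).mul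
        (EntireBddOnStrip.suppPow σ' _ _))
  have hd : Differentiable ℂ f := Differentiable.fun_sum fun i _ => (hgE i).differentiable_trace
  have hbdd : BddAbove ((norm ∘ f) '' Complex.HadamardThreeLines.verticalClosedStrip 0 1) := by
    choose C hC using fun i => (hgE i).exists_norm_trace_le
    refine ⟨∑ i, C i, ?_⟩
    rintro _ ⟨z, hz, rfl⟩
    exact (norm_sum_le _ _).trans (Finset.sum_le_sum fun i _ => hC i z hz)
  set X₁ : ℂ → Matrix n n ℂ := fun z => suppPow A ((p - p * z) / 2) with hX₁
  set Y₁ : ℂ → Matrix m m ℂ := fun z => suppPow B (p * z / 2) with hY₁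
  have hXX : ∀ z, X z = X₁ z * X₁ z := fun z => by
    simp only [hX, hX₁]
    rw [← suppPow_add hA.1]
    congr 1
    push_cast
    ring
  have hYY : ∀ z, Y z = Y₁ z * Y₁ z := fun z => by
    simp only [hY, hY₁]
    rw [← suppPow_add hB.1]
    congr 1
    push_cast
    ring
  have hle : ∀ (c : ℝ) (z : ℂ),
      ∑ i, frobSq (Y₁ z * (T z * (K i * (S z * X₁ z)))) ≤ c →
      ∑ i, frobSq (X₁ z * (S z * ((K i)ᴴ * (T z * Y₁ z)))) ≤ c → ‖f z‖ ≤ c := by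
    intro c z h1 h2
    have h3 : ‖f z‖ ≤ ∑ i, (frobSq (Y₁ z * (T z * (K i * (S z * X₁ z)))) +
        frobSq (X₁ z * (S z * ((K i)ᴴ * (T z * Y₁ z))))) / 2 := by
      refine (norm_sum_le _ _).trans (Finset.sum_le_sum fun i _ => ?_)
      refine le_trans (le_of_eq ?_) (norm_trace_mul_le _ _)
      congr 1
      simp only [hg]
      rw [hXX, hYY, Matrix.mul_assoc (Y₁ z), trace_mul_comm (Y₁ z)]
      simp only [Matrix.mul_assoc]
    rw [← Finset.sum_div, Finset.sum_add_distrib] at h3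
    linarith
  have h0 : ∀ z ∈ Complex.re ⁻¹' {0}, ‖f z‖ ≤ a := by
    intro z hz
    have hz : z.re = 0 := hz
    refine hle a z ?_ ?_
    · refine (sum_frobSq_le_of_re_eq_zero hK hσ.1 hσp.1 hA.1 hB.1 ?_ ?_ ?_ _).trans (le_of_eq ?_)
      · simp [hz]
      · simp [hz]
      · simp [hz]
      · simp [hz, ha, mul_div_cancel₀]
    · simp only [hX₁, hY₁, hS, hT]
      rw [Finset.sum_congr rfl fun i _ => (frobSq_conjTranspose _).symm]
      simp only [conjTranspose_mul,
        conjTranspose_conjTranspose, suppPow_conjTranspose hσ.1, suppPow_conjTranspose hσp.1,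
        suppPow_conjTranspose hA.1, suppPow_conjTranspose hB.1, Matrix.mul_assoc]
      refine (sum_frobSq_le_of_re_eq_zero hK hσ.1 hσp.1 hA.1 hB.1 ?_ ?_ ?_ _).trans (le_of_eq ?_)
      · simp [hz]
      · simp [hz]
      · simp [hz]
      · simp [hz, ha, mul_div_cancel₀]
  have h1 : ∀ z ∈ Complex.re ⁻¹' {1}, ‖f z‖ ≤ b := by
    intro z hz
    have hz : z.re = 1 := hz
    refine hle b z ?_ ?_
    · simp only [hX₁, hY₁, hS, hT]
      rw [Finset.sum_congr rfl fun i _ => (frobSq_conjTranspose _).symm]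
      simp only [conjTranspose_mul,
        suppPow_conjTranspose hσ.1, suppPow_conjTranspose hσp.1,
        suppPow_conjTranspose hA.1, suppPow_conjTranspose hB.1, Matrix.mul_assoc]
      refine (sum_frobSq_le_of_re_eq_half hσ hσ' hA.1 hB.1 ?_ ?_ ?_ _).trans (le_of_eq ?_)
      · simp [hz]
      · simp [hz]
      · simp [hz]
      · simp [hz, hb, mul_div_cancel₀]
    · refine (sum_frobSq_le_of_re_eq_half hσ hσ' hA.1 hB.1 ?_ ?_ ?_ _).trans (le_of_eq ?_)
      · simp [hz]
      · simp [hz]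
      · simp [hz]
      · simp [hz, hb, mul_div_cancel₀]
  have hz : ((1 - 1 / p : ℝ) : ℂ) ∈ Complex.HadamardThreeLines.verticalClosedStrip 0 1 := by
    have : 1 / p ≤ 1 := (div_le_one hp0).2 hp.le
    have : 0 ≤ 1 / p := by positivity
    constructor <;> simp only [Complex.ofReal_re] <;> linarith
  have hkey := Complex.HadamardThreeLines.norm_le_interp_of_mem_verticalClosedStrip₀₁' f hz
    hd.diffContOnCl hbdd h0 h1
  have hfz : f ((1 - 1 / p : ℝ) : ℂ) = (suppPow B p).trace := by
    set w : ℂ := ((1 - 1 / p : ℝ) : ℂ) with hw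
    have hSw : S w = suppPow σ ((-s : ℝ) : ℂ) := by
      simp only [hS, hw, hs]
      congr 1
      norm_cast
      field_simp
      ring
    have hTw : T w = suppPow σ' s := by
      simp only [hT, hw, hs]
      congr 1
      norm_cast
      field_simp
      ring
    have hXw : X w = A := by
      simp only [hX, hw]
      conv_rhs => rw [← suppPow_one hA.1 hA]
      congr 1
      norm_cast
      field_simp
      ring
    have hYw : Y w = suppPow B ((p - 1 : ℝ) : ℂ) := by
      simp only [hY, hw]
      congr 1
      norm_cast
      field_simp
      ring
    have hSA : S w * A * S w = ρ := by
      obtain ⟨hr, hl⟩ := suppPow_zero_mul_of_dominates hσ hρ.1 h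
      calc S w * A * S w = (S w * suppPow σ s) * ρ * (suppPow σ s * S w) := by
            rw [hAdef]; simp only [Matrix.mul_assoc]
        _ = ρ := by
            rw [hSw, ← suppPow_add hσ.1, ← suppPow_add hσ.1, ← Complex.ofReal_add,
              ← Complex.ofReal_add, neg_add_cancel, add_neg_cancel, Complex.ofReal_zero, hl, hr]
    calc f w = (Y w * (T w * (∑ i, K i * (S w * A * S w) * (K i)ᴴ) * T w)).trace := by
          simp only [hf, hg, hXw, Matrix.mul_sum, Matrix.sum_mul, trace_sum, Matrix.mul_assoc]
      _ = (suppPow B p).trace := by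
          rw [hSA, ← hρ', hTw, ← hBdef, hYw]
          conv_lhs => enter [1, 2]; rw [← suppPow_one hB.1 hB]
          rw [← suppPow_add hB.1]
          congr 2
          push_cast
          ring
  have hba : b ≤ a ^ (1 / p) * b ^ (1 - 1 / p) := by
    rw [hfz] at hkey
    simp only [Complex.ofReal_re, sub_sub_cancel] at hkey
    exact (Complex.re_le_norm _).trans hkey
  rcases hb0.eq_or_lt with hb1 | hb1
  · rw [← hb1]; exact ha0
  have hp1 : 0 < 1 / p := by positivity
  rw [Real.rpow_sub hb1, Real.rpow_one, mul_div_assoc', le_div_iff₀ (by positivity), mul_comm,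
    mul_le_mul_iff_left₀ hb1] at hba
  exact (Real.rpow_le_rpow_iff hb0 ha0 hp1).1 hba

end DataProcessing

/-- data-processing inequality for the sandwiched Rényi divergence with
`α ∈ (1, 2]`, for a CPTP map given in Kraus form. -/
theorem stmt8 {n m k : ℕ} {α : ℝ} (hα : α ∈ Set.Ioc (1 : ℝ) 2)
    {ρ σ : Matrix (Fin n) (Fin n) ℂ}
    (hρ : ρ.PosSemidef) (hσ : σ.PosSemidef) (hρ0 : ρ ≠ 0)
    (K : Fin k → Matrix (Fin m) (Fin n) ℂ)
    (hK : ∑ i, (K i)ᴴ * K i = 1) :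
    Dtilde α (∑ i, K i * ρ * (K i)ᴴ) (∑ i, K i * σ * (K i)ᴴ) ≤ Dtilde α ρ σ := by
  obtain ⟨hα1, -⟩ := hα
  have hα0 : ¬ α < 1 := by linarith
  by_cases hdom : dominates σ ρ
  swap
  · rw [Dtilde, Dtilde, if_neg (c := (ρ * σ).trace ≠ 0 ∧ _) (by tauto)]
    exact le_top
  set ρ' := ∑ i, K i * ρ * (K i)ᴴ with hρ'
  set σ' := ∑ i, K i * σ * (K i)ᴴ with hσ'
  have hρp : ρ'.PosSemidef := posSemidef_sum_mul_mul_conjTranspose hρ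
  have hσp : σ'.PosSemidef := posSemidef_sum_mul_mul_conjTranspose hσ
  have hdom' : dominates σ' ρ' := dominates_sum_mul_mul_conjTranspose hσ hdom
  have htr : ρ'.trace = ρ.trace := trace_sum_mul_mul_conjTranspose hK ρ
  have hρ0' : ρ' ≠ 0 := fun h => hρ0 (hρ.trace_eq_zero_iff.1 (by rw [← htr, h, trace_zero]))
  have htr0 : 0 < ρ.trace.re := by
    have h1 := lt_of_le_of_ne hρ.trace_nonneg (Ne.symm (mt hρ.trace_eq_zero_iff.1 hρ0))
    exact (Complex.lt_def.1 h1).1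
  rw [Dtilde, Dtilde,
    if_pos ⟨mt (eq_zero_of_dominates_of_trace_mul_eq_zero hρp hσp hdom') hρ0', .inl hdom'⟩,
    if_pos ⟨mt (eq_zero_of_dominates_of_trace_mul_eq_zero hρ hσ hdom) hρ0, .inl hdom⟩,
    htr, EReal.coe_le_coe_iff, matPow_eq_suppPow hσ, matPow_eq_suppPow hσp,
    matPow_eq_suppPow (posSemidef_suppPow_mul_mul_suppPow hρ hσ.1 _),
    matPow_eq_suppPow (posSemidef_suppPow_mul_mul_suppPow hρp hσp.1 _)]
  have hle := trace_suppPow_sandwich_le hK hα1 hρ hσ hdom hρ' hσ' rfl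
  have hpos := trace_suppPow_sandwich_pos hρp hσp hdom' hρ0' ((1 - α) / (2 * α)) α
  refine mul_le_mul_of_nonneg_left ?_ (inv_nonneg.2 (by linarith))
  exact Real.logb_le_logb_of_le one_lt_two (div_pos hpos htr0)
    (div_le_div_of_nonneg_right hle htr0.le)
end
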